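/- For all f, g : S → ℤ/2ℤ and every x ∈ S: h⁽¹⁾(x) equals the sum, over all pairs (y, z) with y ⪯ x and z ⪯ x such that y_q ⋈ z_q = D for every position q with x_q = D, and y_q ⋈ z_q = x_q for every position q with x_q ∈ classA = {𝟎, D*, C, C⁺}, of f(y) · g(z). -/

import Mathlib

/-- The six states `𝟎, D, D*, C, C⁺, C*`. -/
inductive S0 : Type
  | O | D | Ds | C | Cp | Cs
  deriving DecidableEq

instance : Fintype S0 where
  elems := {.O, .D, .Ds, .C, .Cp, .Cs}
  complete := by intro x; cases x <;> decide

/-- The order `≤` on states, generated by `𝟎 < D < D* < C⁺ < C*` and `𝟎 < C < C⁺`. -/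
def le0 : S0 → S0 → Bool
  | .O, _ => true
  | .D, .D => true | .D, .Ds => true | .D, .Cp => true | .D, .Cs => true
  | .Ds, .Ds => true | .Ds, .Cp => true | .Ds, .Cs => true
  | .C, .C => true | .C, .Cp => true | .C, .Cs => true
  | .Cp, .Cp => true | .Cp, .Cs => true
  | .Cs, .Cs => true
  | _, _ => false

/-- The order `≤₁`: `a ≤₁ b` iff `a = b` or `b = C*`. -/
def le1 : S0 → S0 → Bool := fun a b => a == b || b == .Cs

/-- The order `≤₂`: `a ≤₂ b` iff `a = b`, or `b = C⁺` and `a ∈ {𝟎, D, D*, C}`, or `b = D*`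
and `a ∈ {𝟎, D}`, or `b = C` and `a = 𝟎`. -/
def le2 : S0 → S0 → Bool := fun a b =>
  a == b || (b == .Cp && (a == .O || a == .D || a == .Ds || a == .C)) ||
    (b == .Ds && (a == .O || a == .D)) || (b == .C && a == .O)

/-- The order `≤₃`: `a ≤₃ b` iff `a = b`, or `a = 𝟎` and `b = D`. -/
def le3 : S0 → S0 → Bool := fun a b => a == b || (a == .O && b == .D)

/-- The commutative join operation `⋈` on states. -/
def jn : S0 → S0 → S0
  | .O, a => a
  | a, .O => a
  | .Cs, _ => .Cs
  | _, .Cs => .Cs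
  | .D, .D => .Ds | .D, .Ds => .Ds | .Ds, .D => .Ds | .Ds, .Ds => .Ds
  | .D, .C => .Cp | .D, .Cp => .Cp | .Ds, .C => .Cp | .Ds, .Cp => .Cp
  | .C, .D => .Cp | .Cp, .D => .Cp | .C, .Ds => .Cp | .Cp, .Ds => .Cp
  | .C, .C => .Cs | .C, .Cp => .Cs | .Cp, .C => .Cs | .Cp, .Cp => .Cs

/-- The zeta matrix of the componentwise order induced by a base relation `r` on `S0`:
its `(x, y)` entry is `1` if `y ⊑ x` and `0` otherwise. -/
def zMat (k : ℕ) (r : S0 → S0 → Bool) : Matrix (Fin k → S0) (Fin k → S0) (ZMod 2) :=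
  Matrix.of fun x y => if ∀ q, r (y q) (x q) = true then 1 else 0

/-- The zeta transform `ζf(x) = Σ_{y ⊑ x} f(y)` of the componentwise order of `r`. -/
def zetaT (k : ℕ) (r : S0 → S0 → Bool) (f : (Fin k → S0) → ZMod 2) :
    (Fin k → S0) → ZMod 2 :=
  (zMat k r).mulVec f

/-- The Möbius transform of the componentwise order of `r`: the inverse of the zeta
transform. -/
noncomputable def muT (k : ℕ) (r : S0 → S0 → Bool) (f : (Fin k → S0) → ZMod 2) :
    (Fin k → S0) → ZMod 2 :=
  (zMat k r)⁻¹.mulVec f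

/-- The number of coordinates of `x` whose state is in `classC = {C, C⁺}`. -/
def cardC (k : ℕ) (x : Fin k → S0) : ℕ :=
  (Finset.univ.filter fun q => x q = S0.C ∨ x q = S0.Cp).card

/-- The number of coordinates of `x` whose state is in `classD = {D}`. -/
def cardD (k : ℕ) (x : Fin k → S0) : ℕ :=
  (Finset.univ.filter fun q => x q = S0.D).card

/-- The number of coordinates where both `x` and `y` have a state in `classC`. -/
def cardCC (k : ℕ) (x y : Fin k → S0) : ℕ :=
  (Finset.univ.filter fun q => (x q = S0.C ∨ x q = S0.Cp) ∧ (y q = S0.C ∨ y q = S0.Cp)).card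

/-- The number of coordinates where both `x` and `y` have state `D`. -/
def cardDD (k : ℕ) (x y : Fin k → S0) : ℕ :=
  (Finset.univ.filter fun q => x q = S0.D ∧ y q = S0.D).card

/-- The filter `f|ᵢ^{classC}`. -/
def restrC (k : ℕ) (i : ℕ) (f : (Fin k → S0) → ZMod 2) : (Fin k → S0) → ZMod 2 :=
  fun x => if cardC k x = i then f x else 0

/-- The filter `f|ⱼ^{classD}`. -/
def restrD (k : ℕ) (j : ℕ) (f : (Fin k → S0) → ZMod 2) : (Fin k → S0) → ZMod 2 :=
  fun x => if cardD k x = j then f x else 0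

/-- `f⁽³⁾_{i,j} = ζ₃ ((ζ₂ ((ζ₁ f)|ᵢ^{classC}))|ⱼ^{classD})`. -/
def F3 (k : ℕ) (f : (Fin k → S0) → ZMod 2) (i j : ℕ) : (Fin k → S0) → ZMod 2 :=
  zetaT k le3 (restrD k j (zetaT k le2 (restrC k i (zetaT k le1 f))))

/-- `h⁽³⁾_{i,j} = Σ_{i₁+i₂=i, j₁+j₂=j} f⁽³⁾_{i₁,j₁} · g⁽³⁾_{i₂,j₂}` (pointwise product). -/
def H3 (k : ℕ) (f g : (Fin k → S0) → ZMod 2) (i j : ℕ) : (Fin k → S0) → ZMod 2 :=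
  fun x => ∑ a ∈ Finset.HasAntidiagonal.antidiagonal i, ∑ b ∈ Finset.HasAntidiagonal.antidiagonal j,
    F3 k f a.1 b.1 x * F3 k g a.2 b.2 x

/-- `h⁽²⁾_{i,j} = μ₃ h⁽³⁾_{i,j}`. -/
noncomputable def H2 (k : ℕ) (f g : (Fin k → S0) → ZMod 2) (i j : ℕ) :
    (Fin k → S0) → ZMod 2 :=
  muT k le3 (H3 k f g i j)

/-- `h⁽²⁾ᵢ(x) = h⁽²⁾_{i,j}(x)` for `j = |{q : x_q = D}|`. -/
noncomputable def H2i (k : ℕ) (f g : (Fin k → S0) → ZMod 2) (i : ℕ) :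
    (Fin k → S0) → ZMod 2 :=
  fun x => H2 k f g i (cardD k x) x

/-- `h⁽¹⁾ᵢ = μ₂ h⁽²⁾ᵢ`. -/
noncomputable def H1i (k : ℕ) (f g : (Fin k → S0) → ZMod 2) (i : ℕ) :
    (Fin k → S0) → ZMod 2 :=
  muT k le2 (H2i k f g i)

/-- `h⁽¹⁾(x) = h⁽¹⁾ᵢ(x)` for `i = |{q : x_q ∈ classC}|`. -/
noncomputable def H1 (k : ℕ) (f g : (Fin k → S0) → ZMod 2) : (Fin k → S0) → ZMod 2 :=
  fun x => H1i k f g (cardC k x) x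

open Polynomial

/-- The `k`-fold tensor power of a matrix indexed by the states. -/
def tensorPow {R : Type*} [CommRing R] (k : ℕ) (M : Matrix S0 S0 R) :
    Matrix (Fin k → S0) (Fin k → S0) R :=
  Matrix.of fun x y => ∏ q, M (x q) (y q)

/-- The zeta matrix of a relation on the states. -/
def stateZeta (r : S0 → S0 → Bool) : Matrix S0 S0 (ZMod 2) :=
  Matrix.of fun x y => if r y x = true then 1 else 0

/-- The Möbius matrix of `≤₂` modulo `2`. -/
def stateMobius2 : Matrix S0 S0 (ZMod 2) :=
  stateZeta le2 * (stateZeta le2 * stateZeta le2)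

/-- `1` on `classC` and `0` elsewhere. -/
def degC (a : S0) : ℕ := if a = S0.C ∨ a = S0.Cp then 1 else 0

/-- `1` on `classD` and `0` elsewhere. -/
def degD (a : S0) : ℕ := if a = S0.D then 1 else 0

theorem cardC_eq_sum (k : ℕ) (x : Fin k → S0) : cardC k x = ∑ q, degC (x q) := by
  simp only [cardC, degC, Finset.card_filter]

theorem cardD_eq_sum (k : ℕ) (x : Fin k → S0) : cardD k x = ∑ q, degD (x q) := by
  simp only [cardD, degD, Finset.card_filter]

theorem sum_state {R : Type*} [AddCommMonoid R] (h : S0 → R) :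
    ∑ a, h a = h .O + (h .D + (h .Ds + (h .C + (h .Cp + h .Cs)))) := by
  have : (Finset.univ : Finset S0) = {.O, .D, .Ds, .C, .Cp, .Cs} := rfl
  rw [this]
  simp

section TensorPow

variable {R : Type*} [CommRing R] (k : ℕ)

theorem tensorPow_mul (M N : Matrix S0 S0 R) :
    tensorPow k M * tensorPow k N = tensorPow k (M * N) := by
  ext x y
  simp only [tensorPow, Matrix.mul_apply, Matrix.of_apply, ← Finset.prod_mul_distrib]
  exact (Fintype.prod_sum fun q w => M (x q) w * N w (y q)).symm

theorem tensorPow_one : tensorPow k (1 : Matrix S0 S0 R) = 1 := by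
  ext x y
  simp [tensorPow, Matrix.one_apply, Finset.prod_boole, funext_iff]

theorem tensorPow_diagonal (d : S0 → R) :
    tensorPow k (Matrix.diagonal d) = Matrix.diagonal fun x => ∏ q, d (x q) := by
  ext x y
  by_cases h : x = y
  · simp [tensorPow, h]
  · obtain ⟨q, hq⟩ := Function.ne_iff.mp h
    rw [Matrix.diagonal_apply_ne _ h]
    exact Finset.prod_eq_zero (Finset.mem_univ q) (Matrix.diagonal_apply_ne _ hq)

theorem tensorPow_map {T : Type*} [CommRing T] (φ : R →+* T) (M : Matrix S0 S0 R) :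
    (tensorPow k M).map φ = tensorPow k (M.map φ) := by
  ext x y
  simp [tensorPow]

theorem tensorPow_mulVec_bilin (N : Matrix S0 S0 R) (K : S0 → S0 → S0 → R)
    (c : (Fin k → S0) → (Fin k → S0) → R) (x : Fin k → S0) :
    (tensorPow k N).mulVec (fun w => ∑ y, ∑ z, (∏ q, K (w q) (y q) (z q)) * c y z) x =
      ∑ y, ∑ z, (∏ q, ∑ w, N (x q) w * K w (y q) (z q)) * c y z := by
  simp only [Matrix.mulVec, dotProduct, Finset.mul_sum]
  rw [Finset.sum_comm]
  refine Finset.sum_congr rfl fun y _ => ?_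
  rw [Finset.sum_comm]
  refine Finset.sum_congr rfl fun z _ => ?_
  rw [Fintype.prod_sum, Finset.sum_mul]
  refine Finset.sum_congr rfl fun w _ => ?_
  rw [Finset.prod_mul_distrib, mul_assoc]
  rfl

end TensorPow

theorem zMat_eq_tensorPow (k : ℕ) (r : S0 → S0 → Bool) :
    zMat k r = tensorPow k (stateZeta r) := by
  ext x y
  simp [zMat, tensorPow, stateZeta, Finset.prod_boole]

theorem muT_eq_mulVec (k : ℕ) (r : S0 → S0 → Bool) {N : Matrix S0 S0 (ZMod 2)}
    (hN : N * stateZeta r = 1) (f : (Fin k → S0) → ZMod 2) :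
    muT k r f = (tensorPow k N).mulVec f := by
  rw [muT, Matrix.inv_eq_left_inv]
  rw [zMat_eq_tensorPow, tensorPow_mul, hN, tensorPow_one]

theorem mulVec_coeff {R ι : Type*} [CommRing R] [Fintype ι] (M : Matrix ι ι R)
    (p : ι → R[X]) (i : ℕ) (x : ι) :
    M.mulVec (fun y => (p y).coeff i) x = ((M.map C).mulVec p x).coeff i := by
  simp [Matrix.mulVec, dotProduct, Polynomial.finsetSum_coeff]

theorem coeff_prod_of_X_pow_dvd {R ι : Type*} [CommRing R] (s : Finset ι) (e : ι → ℕ)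
    (p : ι → R[X]) (h : ∀ q ∈ s, X ^ e q ∣ p q) :
    (∏ q ∈ s, p q).coeff (∑ q ∈ s, e q) = ∏ q ∈ s, (p q).coeff (e q) := by
  choose! r hr using h
  rw [Finset.prod_congr rfl hr, Finset.prod_mul_distrib, Finset.prod_pow_eq_pow_sum]
  have hc : ∀ (n : ℕ) (t : R[X]), (X ^ n * t).coeff n = t.coeff 0 := fun n t => by
    simpa using Polynomial.coeff_X_pow_mul t n 0
  rw [hc, Polynomial.coeff_zero_prod]
  exact Finset.prod_congr rfl fun q hq => by rw [hr q hq, hc]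

/-- The single-coordinate matrix of `ζ₂ ∘ ζ₁` with `classC` marked by the variable in between. -/
noncomputable def markedC : Matrix S0 S0 (ZMod 2)[X] :=
  (stateZeta le2).map C * (Matrix.diagonal (fun a => X ^ degC a) * (stateZeta le1).map C)

/-- The single-coordinate matrix of `ζ₃ ∘ ζ₂ ∘ ζ₁` with `classC` and `classD` marked by the
inner and the outer variable. -/
noncomputable def markedCD : Matrix S0 S0 (ZMod 2)[X][X] :=
  ((stateZeta le3).map C).map C *
    (Matrix.diagonal (fun a => X ^ degD a) * markedC.map C)

theorem zetaT_restrC_zetaT (k : ℕ) (f : (Fin k → S0) → ZMod 2) (i : ℕ) (x : Fin k → S0) :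
    zetaT k le2 (restrC k i (zetaT k le1 f)) x =
      ((tensorPow k markedC).mulVec (fun y => C (f y)) x).coeff i := by
  have h : restrC k i (zetaT k le1 f) = fun x =>
      (((tensorPow k (Matrix.diagonal fun a => (X : (ZMod 2)[X]) ^ degC a)).mulVec
        ((tensorPow k ((stateZeta le1).map C)).mulVec fun y => C (f y))) x).coeff i := by
    funext x
    have hz : (tensorPow k ((stateZeta le1).map C)).mulVec (fun y => C (f y)) x =
        C (zetaT k le1 f x) := by
      rw [← tensorPow_map, zetaT, zMat_eq_tensorPow]
      simp [Matrix.mulVec, dotProduct]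
    rw [tensorPow_diagonal, Matrix.mulVec_diagonal, hz, Finset.prod_pow_eq_pow_sum,
      ← cardC_eq_sum, mul_comm, Polynomial.coeff_C_mul, Polynomial.coeff_X_pow, restrC]
    simp [eq_comm]
  rw [h, zetaT, zMat_eq_tensorPow, mulVec_coeff, tensorPow_map, Matrix.mulVec_mulVec,
    Matrix.mulVec_mulVec, tensorPow_mul, tensorPow_mul, Matrix.mul_assoc, ← markedC]

theorem F3_eq_coeff (k : ℕ) (f : (Fin k → S0) → ZMod 2) (i j : ℕ) (x : Fin k → S0) :
    F3 k f i j x =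
      (((tensorPow k markedCD).mulVec (fun y => C (C (f y))) x).coeff j).coeff i := by
  have h : restrD k j (zetaT k le2 (restrC k i (zetaT k le1 f))) = fun x =>
      ((((tensorPow k (Matrix.diagonal fun a => (X : (ZMod 2)[X][X]) ^ degD a)).mulVec
        ((tensorPow k (markedC.map C)).mulVec fun y => C (C (f y)))) x).coeff j).coeff i := by
    funext x
    have hz : (tensorPow k (markedC.map C)).mulVec (fun y => C (C (f y))) x =
        C ((tensorPow k markedC).mulVec (fun y => C (f y)) x) := by
      rw [← tensorPow_map]
      simp [Matrix.mulVec, dotProduct]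
    rw [tensorPow_diagonal, Matrix.mulVec_diagonal, hz, Finset.prod_pow_eq_pow_sum,
      ← cardD_eq_sum, mul_comm, Polynomial.coeff_C_mul, Polynomial.coeff_X_pow, restrD,
      zetaT_restrC_zetaT]
    rcases eq_or_ne (cardD k x) j with hj | hj
    · simp [hj]
    · simp [hj, hj.symm]
  rw [F3, h, zetaT, zMat_eq_tensorPow, mulVec_coeff, mulVec_coeff, tensorPow_map, tensorPow_map,
    Matrix.mulVec_mulVec, Matrix.mulVec_mulVec, tensorPow_mul, tensorPow_mul,
    Matrix.mul_assoc, ← markedCD]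

theorem H3_eq_coeff (k : ℕ) (f g : (Fin k → S0) → ZMod 2) (i j : ℕ) (x : Fin k → S0) :
    H3 k f g i j x =
      ((∑ y, ∑ z, (∏ q, markedCD (x q) (y q) * markedCD (x q) (z q)) *
        C (C (f y * g z))).coeff j).coeff i := by
  have h : ∑ y, ∑ z, (∏ q, markedCD (x q) (y q) * markedCD (x q) (z q)) * C (C (f y * g z)) =
      (tensorPow k markedCD).mulVec (fun y => C (C (f y))) x *
        (tensorPow k markedCD).mulVec (fun y => C (C (g y))) x := by
    simp only [Matrix.mulVec, dotProduct, Finset.sum_mul_sum, tensorPow, Matrix.of_apply,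
      Finset.prod_mul_distrib, map_mul]
    exact Finset.sum_congr rfl fun y _ => Finset.sum_congr rfl fun z _ => by ring
  rw [h, Polynomial.coeff_mul, Polynomial.finsetSum_coeff, H3, Finset.sum_comm]
  simp only [Polynomial.coeff_mul, F3_eq_coeff]

/-- The single-coordinate kernel of the bilinear map taking `f, g` to the generating function
of the `h⁽²⁾ᵢ`. -/
noncomputable def kernelD (x y z : S0) : (ZMod 2)[X] :=
  if x = S0.D then markedC .O y * markedC .D z + markedC .D y * markedC .O z
  else markedC x y * markedC x z

theorem markedCD_apply (x y : S0) :
    markedCD x y = if x = S0.D then C (markedC .O y) + C (markedC .D y) * X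
      else C (markedC x y) := by
  rw [markedCD, Matrix.mul_apply]
  simp only [Matrix.diagonal_mul, Matrix.map_apply]
  cases x <;> simp [sum_state, stateZeta, le3, degD, Polynomial.X_mul_C]

theorem sum_stateZeta_le3_mul (x y z : S0) :
    ∑ w, ((stateZeta le3).map C).map C x w * (markedCD w y * markedCD w z) =
      X ^ degD x * (C (kernelD x y z) +
        if x = S0.D then C (markedC .D y * markedC .D z) * X else 0) := by
  have h2 : ((2 : ℕ) : (ZMod 2)[X][X]) = 0 := CharP.cast_eq_zero _ 2
  cases x <;> simp [sum_state, stateZeta, le3, degD, markedCD_apply, kernelD]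
  linear_combination (C (markedC .O y) * C (markedC .O z)) * h2

theorem H2i_eq_coeff (k : ℕ) (f g : (Fin k → S0) → ZMod 2) (i : ℕ) (x : Fin k → S0) :
    H2i k f g i x =
      (∑ y, ∑ z, (∏ q, kernelD (x q) (y q) (z q)) * C (f y * g z)).coeff i := by
  have hN : stateZeta le3 * stateZeta le3 = 1 := by decide +kernel
  rw [H2i, H2, muT_eq_mulVec k le3 hN, funext (H3_eq_coeff k f g i _), mulVec_coeff,
    mulVec_coeff, tensorPow_map, tensorPow_map,
    tensorPow_mulVec_bilin k _ (fun w y z => markedCD w y * markedCD w z)]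
  simp only [Polynomial.finsetSum_coeff, Polynomial.coeff_mul_C, cardD_eq_sum]
  refine Finset.sum_congr rfl fun y _ => Finset.sum_congr rfl fun z _ => ?_
  rw [coeff_prod_of_X_pow_dvd _ (fun q => degD (x q)) _ fun q _ => by
    rw [sum_stateZeta_le3_mul]; exact dvd_mul_right _ _]
  congr 2
  refine Finset.prod_congr rfl fun q _ => ?_
  rw [sum_stateZeta_le3_mul]
  have := Polynomial.coeff_X_pow_mul (C (kernelD (x q) (y q) (z q)) +
    if x q = S0.D then C (markedC .D (y q) * markedC .D (z q)) * X else 0) (degD (x q)) 0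
  rw [zero_add] at this
  rw [this]
  split_ifs <;> simp

/-- The condition on a single coordinate of the pairs that contribute to `h⁽¹⁾`. -/
def Contributes (x y z : S0) : Prop :=
  le0 y x = true ∧ le0 z x = true ∧ (x = S0.D → jn y z = S0.D) ∧
    ((x = S0.O ∨ x = S0.Ds ∨ x = S0.C ∨ x = S0.Cp) → jn y z = x)

instance (x y z : S0) : Decidable (Contributes x y z) :=
  inferInstanceAs (Decidable (_ ∧ _))

/-- The coefficients of degree `0` and `1` of `markedC`. -/
def markedCCoeff (n : ℕ) (x y : S0) : ZMod 2 :=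
  ∑ w, stateZeta le2 x w * ((if n = degC w then 1 else 0) * stateZeta le1 w y)

theorem markedC_coeff (n : ℕ) (x y : S0) : (markedC x y).coeff n = markedCCoeff n x y := by
  rw [markedC, markedCCoeff, Matrix.mul_apply]
  simp only [Polynomial.finsetSum_coeff, Matrix.diagonal_mul, Matrix.map_apply,
    Polynomial.coeff_C_mul, Polynomial.coeff_mul_C, Polynomial.coeff_X_pow]

/-- The constant coefficient of `kernelD`. -/
def kernelDCoeffZero (x y z : S0) : ZMod 2 :=
  if x = S0.D then markedCCoeff 0 .O y * markedCCoeff 0 .D z +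
    markedCCoeff 0 .D y * markedCCoeff 0 .O z
  else markedCCoeff 0 x y * markedCCoeff 0 x z

/-- The linear coefficient of a product of two entries of `markedC`. -/
def mulCoeffOne (x x' y z : S0) : ZMod 2 :=
  markedCCoeff 0 x y * markedCCoeff 1 x' z + markedCCoeff 1 x y * markedCCoeff 0 x' z

/-- The linear coefficient of `kernelD`. -/
def kernelDCoeffOne (x y z : S0) : ZMod 2 :=
  if x = S0.D then mulCoeffOne .O .D y z + mulCoeffOne .D .O y z else mulCoeffOne x x y z

theorem kernelD_coeff_zero (x y z : S0) :
    (kernelD x y z).coeff 0 = kernelDCoeffZero x y z := by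
  unfold kernelD kernelDCoeffZero
  split_ifs <;> simp [markedC_coeff, Polynomial.mul_coeff_zero]

theorem kernelD_coeff_one (x y z : S0) :
    (kernelD x y z).coeff 1 = kernelDCoeffOne x y z := by
  unfold kernelD kernelDCoeffOne mulCoeffOne
  split_ifs <;> simp [markedC_coeff, Polynomial.mul_coeff_one]

theorem sum_stateMobius2_coeff_zero (x y z : S0) :
    (∑ w, stateMobius2.map C x w * kernelD w y z).coeff 0 =
      if degC x = 0 ∧ Contributes x y z then 1 else 0 := by
  simp only [Polynomial.finsetSum_coeff, Matrix.map_apply, Polynomial.coeff_C_mul,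
    kernelD_coeff_zero]
  revert x y z
  decide +kernel

theorem sum_stateMobius2_coeff_one (x y z : S0) (hx : degC x = 1) :
    (∑ w, stateMobius2.map C x w * kernelD w y z).coeff 1 =
      if Contributes x y z then 1 else 0 := by
  simp only [Polynomial.finsetSum_coeff, Matrix.map_apply, Polynomial.coeff_C_mul,
    kernelD_coeff_one]
  revert x y z
  decide +kernel

theorem sum_stateMobius2_coeff_degC (x y z : S0) :
    X ^ degC x ∣ ∑ w, stateMobius2.map C x w * kernelD w y z ∧
      (∑ w, stateMobius2.map C x w * kernelD w y z).coeff (degC x) =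
        if Contributes x y z then 1 else 0 := by
  have h : degC x = 0 ∨ degC x = 1 := by unfold degC; split_ifs <;> simp
  rcases h with h | h
  · rw [h, sum_stateMobius2_coeff_zero]
    simp [h]
  · rw [h, sum_stateMobius2_coeff_one x y z h, pow_one, Polynomial.X_dvd_iff,
      sum_stateMobius2_coeff_zero]
    simp [h]

/-- `h⁽¹⁾(x)` equals the sum over all pairs `(y, z)` with `y ⪯ x`,
`z ⪯ x`, `y_q ⋈ z_q = D` at every position with `x_q = D`, and `y_q ⋈ z_q = x_q` at every
position with `x_q ∈ classA = {𝟎, D*, C, C⁺}`, of `f(y) · g(z)`. -/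
theorem H1_eq_sum (k : ℕ) (f g : (Fin k → S0) → ZMod 2) (x : Fin k → S0) :
    H1 k f g x =
      ∑ y : Fin k → S0, ∑ z : Fin k → S0,
        if (∀ q, le0 (y q) (x q) = true) ∧ (∀ q, le0 (z q) (x q) = true) ∧
            (∀ q, x q = S0.D → jn (y q) (z q) = S0.D) ∧
            (∀ q, (x q = S0.O ∨ x q = S0.Ds ∨ x q = S0.C ∨ x q = S0.Cp) →
              jn (y q) (z q) = x q) then
          f y * g z
        else 0 := by
  have hN : stateMobius2 * stateZeta le2 = 1 := by decide +kernel
  rw [H1, H1i, muT_eq_mulVec k le2 hN, funext (H2i_eq_coeff k f g _), mulVec_coeff,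
    tensorPow_map, tensorPow_mulVec_bilin]
  simp only [Polynomial.finsetSum_coeff, Polynomial.coeff_mul_C, cardC_eq_sum]
  refine Finset.sum_congr rfl fun y _ => Finset.sum_congr rfl fun z _ => ?_
  rw [coeff_prod_of_X_pow_dvd _ (fun q => degC (x q)) _ fun q _ =>
      (sum_stateMobius2_coeff_degC _ _ _).1,
    Finset.prod_congr rfl fun q _ => (sum_stateMobius2_coeff_degC _ _ _).2, Finset.prod_boole]
  simp only [Contributes, Finset.mem_univ, true_imp_iff, forall_and, ite_mul, one_mul, zero_mul]
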